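/- arXiv:2301.05470 — 5 statements merged into one kernel-verified Lean document; each statement's English description precedes it below -/
import Mathlib

section
/- The ring A' = A[T_1,…,T_r]/(T_1^{n_1} − f_1, …, T_r^{n_r} − f_r) is a local ring whose maximal ideal is generated by the image of the maximal ideal of A together with the classes of T_1,…,T_r, and the canonical map A → A' induces an isomorphism from the residue field k of A onto the residue field of A'. Moreover, if A is henselian, then A' is a henselian local ring. -/
open MvPolynomial

/-- The Kummer-type quotient `A' = A[T₁,…,T_r]/(T₁^{n₁} − f₁, …, T_r^{n_r} − f_r)`. -/
abbrev kummerQuot {A : Type*} [CommRing A] {r : ℕ} (f : Fin r → A) (n : Fin r → ℕ) : Type _ :=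
  MvPolynomial (Fin r) A ⧸
    Ideal.span (Set.range fun i : Fin r => (X i : MvPolynomial (Fin r) A) ^ n i - C (f i))

universe u

/-- Étale algebras over a henselian local ring have sections through rational points. -/
theorem HenselianLocalRing.exists_algHom_of_etale {A K : Type u} [CommRing A]
    [HenselianLocalRing A] [Field K] [Algebra A K] (hK : Function.Surjective (algebraMap A K))
    {S : Type*} [CommRing S] [Algebra A S] [Algebra.Etale A S] (χ : S →ₐ[A] K) :
    ∃ σ : S →ₐ[A] A, ∀ s, algebraMap A K (σ s) = χ s := by
  have : (RingHom.ker χ).IsPrime := RingHom.ker_isPrime χ.toRingHom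
  obtain ⟨f, hf, hst⟩ := Algebra.IsEtaleAt.exists_isStandardEtale (R := A) (RingHom.ker χ)
  obtain ⟨P⟩ := hst.nonempty_standardEtalePresentation
  let χ' : Localization.Away f →ₐ[A] K :=
    IsLocalization.liftAlgHom (M := .powers f) (f := χ) fun y ↦ by
      obtain ⟨_, n, rfl⟩ := y
      simpa using fun h : χ f = 0 ↦ absurd h hf
  have hχ' (s : S) : χ' (algebraMap S _ s) = χ s := by simp [χ']
  have hx := P.hasMap.map χ'
  have hker := IsLocalRing.ker_eq_maximalIdeal _ hK
  obtain ⟨a₀, ha₀⟩ := hK (χ' P.x)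
  obtain ⟨a, ha, haa₀⟩ := HenselianLocalRing.is_henselian P.f P.monic_f a₀ (by
    rw [← hker, RingHom.mem_ker, ← Polynomial.aeval_algebraMap_apply_eq_algebraMap_eval, ha₀]
    exact hx.1) (by
    have := hx.isUnit_derivative_f.ne_zero
    rw [← ha₀, Polynomial.aeval_algebraMap_apply_eq_algebraMap_eval, Ne, ← RingHom.mem_ker,
      hker] at this
    simpa using this)
  have hax : algebraMap A K a = χ' P.x := by
    rwa [← hker, RingHom.mem_ker, map_sub, ha₀, sub_eq_zero] at haa₀
  have ha' : P.HasMap a := by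
    refine ⟨by simpa [Polynomial.aeval_def] using ha, ?_⟩
    have h : algebraMap A K (Polynomial.aeval a P.g) ≠ 0 := by
      rw [← Polynomial.aeval_algebraMap_apply, hax]
      exact hx.2.ne_zero
    rw [Ne, ← RingHom.mem_ker, hker] at h
    simpa using h
  let τ : Localization.Away f →ₐ[A] A := (P.lift a ha').comp P.equivRing.toAlgHom
  have hτ : (Algebra.ofId A K).comp τ = χ' :=
    P.hom_ext (by simp [τ, Algebra.ofId_apply, hax])
  refine ⟨τ.comp (IsScalarTower.toAlgHom A S _), fun s ↦ ?_⟩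
  rw [← hχ', ← hτ]
  rfl

/-- Coprime factorizations lift along the residue map of a henselian local ring. -/
theorem HenselianLocalRing.exists_eq_mul_isCoprime {A : Type*} [CommRing A] [HenselianLocalRing A]
    (p : Polynomial A) (f g : Polynomial (IsLocalRing.maximalIdeal A).ResidueField)
    (hp : p.Monic) (hf : f.Monic) (hg : g.Monic)
    (h : p.map (algebraMap A _) = f * g) (hfg : IsCoprime f g) :
    ∃ f' g' : Polynomial A, p = f' * g' ∧ IsCoprime f' g' ∧
      f'.map (algebraMap A _) = f ∧ g'.map (algebraMap A _) = g := by
  obtain ⟨S, _, _, _, Q, _, _, f', g', hQ, -, -, hp', hc, hf', hg'⟩ :=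
    Algebra.exists_etale_bijective_residueFieldMap_and_map_eq_mul_and_isCoprime
      _ p f g hp hf hg h hfg
  let ε := AlgEquiv.ofBijective _ hQ
  let χ : S →ₐ[A] (IsLocalRing.maximalIdeal A).ResidueField :=
    ε.symm.toAlgHom.comp (IsScalarTower.toAlgHom A S Q.ResidueField)
  obtain ⟨σ, hσ⟩ := HenselianLocalRing.exists_algHom_of_etale
    (Ideal.algebraMap_residueField_surjective _) χ
  have key (q : Polynomial S) (q₀ : Polynomial (IsLocalRing.maximalIdeal A).ResidueField)
      (hq : q₀.map ε.toAlgHom.toRingHom = q.map (algebraMap S Q.ResidueField)) :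
      (q.map (σ : S →+* A)).map (algebraMap A _) = q₀ := by
    ext i
    have hi := congr(Polynomial.coeff $hq i)
    simp only [Polynomial.coeff_map] at hi ⊢
    refine (hσ _).trans ?_
    change ε.symm (algebraMap S _ _) = _
    rw [← hi]
    exact ε.symm_apply_apply _
  refine ⟨f'.map (σ : S →+* A), g'.map (σ : S →+* A), ?_, ?_, key _ _ hf', key _ _ hg'⟩
  · rw [← Polynomial.map_mul, ← hp', Polynomial.map_map, σ.comp_algebraMap, Algebra.algebraMap_self,
      Polynomial.map_id]
  · exact hc.map (Polynomial.mapRingHom (σ : S →+* A))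

/-- Over a henselian local ring, every element of an integral algebra lies in the same maximal
ideals as some idempotent. -/
theorem HenselianLocalRing.exists_isIdempotentElem_mem_maximal_iff {A : Type*} [CommRing A]
    [HenselianLocalRing A] {C : Type*} [CommRing C] [Algebra A C] [Algebra.IsIntegral A C] (c : C) :
    ∃ e : C, IsIdempotentElem e ∧ ∀ N : Ideal C, N.IsMaximal → (e ∈ N ↔ c ∈ N) := by
  obtain ⟨p, hp, hpc⟩ := Algebra.IsIntegral.isIntegral (R := A) c
  rw [← Polynomial.aeval_def] at hpc
  set κ := (IsLocalRing.maximalIdeal A).ResidueField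
  obtain ⟨q, hq, hq'⟩ := Polynomial.exists_eq_pow_rootMultiplicity_mul_and_not_dvd
    (p.map (algebraMap A κ)) (hp.map _).ne_zero 0
  rw [Polynomial.C_0, sub_zero] at hq hq'
  set k := Polynomial.rootMultiplicity 0 (p.map (algebraMap A κ))
  have hqm : q.Monic := by
    have := congr(Polynomial.leadingCoeff $hq)
    rwa [Polynomial.leadingCoeff_mul, (Polynomial.monic_X_pow k).leadingCoeff, one_mul,
      (hp.map _).leadingCoeff, eq_comm] at this
  obtain ⟨f, g, rfl, ⟨u, v, huv⟩, hf, hg⟩ := HenselianLocalRing.exists_eq_mul_isCoprime p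
    (Polynomial.X ^ k) q hp (Polynomial.monic_X_pow k) hqm hq
    (IsCoprime.pow_left
      ((Polynomial.prime_X (R := κ)).irreducible.coprime_iff_not_dvd.mpr hq'))
  have huv' := congr(Polynomial.aeval c $huv)
  simp only [map_add, map_mul, map_one] at huv' hpc
  have hker (a : A) : algebraMap A κ a = 0 ↔ a ∈ IsLocalRing.maximalIdeal A :=
    Ideal.algebraMap_residueField_eq_zero
  refine ⟨Polynomial.aeval c (u * f), ?_, fun N hN ↦ ?_⟩
  · simp only [IsIdempotentElem, map_mul]
    linear_combination Polynomial.aeval c u * Polynomial.aeval c f * huv' -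
      Polynomial.aeval c u * Polynomial.aeval c v * hpc
  have hNA : N.comap (algebraMap A C) = IsLocalRing.maximalIdeal A :=
    IsLocalRing.eq_maximalIdeal (Ideal.isMaximal_comap_of_isIntegral_of_isMaximal N)
  have hmem (a : A) : algebraMap A C a ∈ N ↔ a ∈ IsLocalRing.maximalIdeal A := by
    rw [← hNA, Ideal.mem_comap]
  have hfg : Polynomial.aeval c f ∈ N ∨ Polynomial.aeval c g ∈ N :=
    hN.isPrime.mem_or_mem (hpc ▸ N.zero_mem)
  rw [map_mul]
  constructor
  · intro he
    by_contra hcN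
    have hfN : Polynomial.aeval c f ∉ N := by
      intro hfN
      have : Polynomial.aeval c (f - Polynomial.X ^ k) ∈ N := by
        rw [Polynomial.aeval_eq_sum_range]
        refine N.sum_mem fun i _ ↦ ?_
        rw [Algebra.smul_def]
        refine N.mul_mem_right _ ?_
        rw [hmem, ← hker, ← Polynomial.coeff_map]
        rw [Polynomial.map_sub, hf, Polynomial.map_pow, Polynomial.map_X, sub_self,
          Polynomial.coeff_zero]
      rw [map_sub, map_pow, Polynomial.aeval_X, Submodule.sub_mem_iff_right _ hfN] at this
      exact hcN (hN.isPrime.mem_of_pow_mem _ this)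
    refine hN.ne_top ((Ideal.eq_top_iff_one _).mpr ?_)
    rw [← huv']
    exact N.add_mem he (N.mul_mem_left _ (hfg.resolve_left hfN))
  · intro hcN
    refine N.mul_mem_left _ (hfg.resolve_right fun hgN ↦ hq' ?_)
    rw [Polynomial.X_dvd_iff, ← hg, Polynomial.coeff_map, hker, ← hmem]
    rw [← Polynomial.divX_mul_X_add g] at hgN
    simpa [Submodule.add_mem_iff_right _ (N.mul_mem_left _ hcN)] using hgN

/-- A local ring that is integral over a henselian local ring is henselian. -/
theorem HenselianLocalRing.of_isIntegral (A : Type*) {B : Type*} [CommRing A]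
    [HenselianLocalRing A] [CommRing B] [IsLocalRing B] [Algebra A B] [Algebra.IsIntegral A B] :
    HenselianLocalRing B := by
  refine ⟨fun g hg b₀ hb₀ hb₀' ↦ ?_⟩
  let C := AdjoinRoot g
  have : Module.Finite B C := hg.finite_adjoinRoot
  have : Algebra.IsIntegral A C := .trans B
  let ψ : C →+* IsLocalRing.ResidueField B :=
    AdjoinRoot.lift (IsLocalRing.residue B) (IsLocalRing.residue B b₀) (by
      rw [Polynomial.eval₂_at_apply, IsLocalRing.residue_eq_zero_iff]
      exact hb₀)
  have hψmk (q : Polynomial B) : ψ (AdjoinRoot.mk g q) = IsLocalRing.residue B (q.eval b₀) :=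
    (AdjoinRoot.lift_mk _ q).trans (Polynomial.eval₂_at_apply _ _)
  have hψ : Function.Surjective ψ := fun z ↦ by
    obtain ⟨b, rfl⟩ := IsLocalRing.residue_surjective z
    exact ⟨AdjoinRoot.mk g (Polynomial.C b), by rw [hψmk, Polynomial.eval_C]⟩
  have hψker : (RingHom.ker ψ).IsMaximal := RingHom.ker_isMaximal_of_surjective ψ hψ
  let y : C := AdjoinRoot.root g - algebraMap B C b₀
  let g₁ := g /ₘ (Polynomial.X - Polynomial.C b₀)
  have hg₁ : (Polynomial.X - Polynomial.C b₀) * g₁ + Polynomial.C (g.eval b₀) = g := by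
    rw [add_comm, ← Polynomial.modByMonic_X_sub_C_eq_C_eval, Polynomial.modByMonic_add_div]
  let h : C := AdjoinRoot.mk g g₁
  have hyh : y * h = - algebraMap B C (g.eval b₀) := by
    have := congr(AdjoinRoot.mk g $hg₁)
    rw [AdjoinRoot.mk_self, map_add, map_mul, map_sub] at this
    exact eq_neg_of_add_eq_zero_left this
  have hψh : ψ h ≠ 0 := by
    have : g.derivative.eval b₀ = g₁.eval b₀ := by
      conv_lhs => rw [← hg₁]
      simp
    rw [hψmk, ← this]
    exact (hb₀'.map _).ne_zero
  obtain ⟨e, he, heN⟩ := HenselianLocalRing.exists_isIdempotentElem_mem_maximal_iff (A := A) h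
  have hψe : ψ e ≠ 0 := fun h0 ↦ hψh ((heN _ hψker).mp h0)
  let D := C ⧸ Ideal.span {1 - e}
  have hD (z : C) : algebraMap C D z = 0 ↔ z * e = 0 := by
    rw [Ideal.Quotient.algebraMap_eq, Ideal.Quotient.eq_zero_iff_mem, Ideal.mem_span_singleton']
    constructor
    · rintro ⟨w, rfl⟩
      rw [mul_assoc, sub_mul, one_mul, he.eq, sub_self, mul_zero]
    · intro hz
      exact ⟨z, by rw [mul_sub, mul_one, hz, sub_zero]⟩
  have hinj (b : B) (hb : algebraMap B D b = 0) : b = 0 := by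
    rw [IsScalarTower.algebraMap_apply B C D, hD] at hb
    obtain ⟨q, hq, rfl⟩ : ∃ q : Polynomial B, q.degree < g.degree ∧ AdjoinRoot.mk g q = e := by
      obtain ⟨q, rfl⟩ := AdjoinRoot.mk_surjective e
      exact ⟨q %ₘ g, Polynomial.degree_modByMonic_lt q hg, AdjoinRoot.mk_eq_mk.mpr
        ⟨-(q /ₘ g), by linear_combination Polynomial.modByMonic_add_div q g⟩⟩
    have hbq : Polynomial.C b * q = 0 := by
      rw [← (Polynomial.modByMonic_eq_self_iff (p := Polynomial.C b * q) hg).mpr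
        ((Polynomial.smul_eq_C_mul (p := q) b ▸ Polynomial.degree_smul_le b q).trans_lt hq), Polynomial.modByMonic_eq_zero_iff_dvd hg]
      exact AdjoinRoot.mk_eq_zero.mp ((map_mul _ _ _).trans hb)
    obtain ⟨i, hi⟩ : ∃ i, IsUnit (q.coeff i) := by
      by_contra! hq
      refine hψe ?_
      rw [hψmk, IsLocalRing.residue_eq_zero_iff, Polynomial.eval_eq_sum_range]
      exact Ideal.sum_mem _ fun i _ ↦ Ideal.mul_mem_right _ _ (hq i)
    refine hi.mul_left_eq_zero.mp ?_
    rw [← Polynomial.coeff_C_mul, hbq, Polynomial.coeff_zero]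
  have hDe : algebraMap C D e = 1 := by
    rw [← sub_eq_zero, ← map_one (algebraMap C D), ← map_sub, hD, sub_mul, one_mul, he.eq, sub_self]
  have hDh : IsUnit (algebraMap C D h) := by
    by_contra hu
    obtain ⟨N, hN, hNh⟩ := exists_max_ideal_of_mem_nonunits hu
    have : (N.comap (algebraMap C D)).IsMaximal :=
      Ideal.comap_isMaximal_of_surjective _ Ideal.Quotient.mk_surjective
    have := (heN _ this).mpr hNh
    rw [Ideal.mem_comap, hDe] at this
    exact hN.ne_top ((Ideal.eq_top_iff_one _).mpr this)
  set m := IsLocalRing.maximalIdeal B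
  have hy (d : D) : algebraMap C D y * d ∈ m • (⊤ : Submodule B D) := by
    obtain ⟨h', hh'⟩ := hDh.exists_right_inv
    have : algebraMap C D y * d = (-g.eval b₀) • (h' * d) := by
      rw [Algebra.smul_def, IsScalarTower.algebraMap_apply B C D, map_neg, ← hyh, map_mul]
      linear_combination -algebraMap C D y * d * hh'
    rw [this]
    exact Submodule.smul_mem_smul (neg_mem hb₀) trivial
  have : Module.Finite B D := .trans C D
  have hsurj : (⊤ : Submodule B D) ≤ LinearMap.range (Algebra.linearMap B D) := by
    refine Submodule.le_of_le_smul_of_le_jacobson_bot Module.Finite.fg_top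
      (IsLocalRing.maximalIdeal_le_jacobson _) fun d _ ↦ ?_
    obtain ⟨z, rfl⟩ := Ideal.Quotient.mk_surjective d
    obtain ⟨q, rfl⟩ := AdjoinRoot.mk_surjective z
    have hq := Polynomial.modByMonic_add_div q (Polynomial.X - Polynomial.C b₀)
    rw [Polynomial.modByMonic_X_sub_C_eq_C_eval] at hq
    rw [← hq, map_add, map_add, map_mul, map_mul]
    exact Submodule.add_mem_sup ⟨q.eval b₀, rfl⟩ (hy _)
  obtain ⟨b, hb⟩ := hsurj (x := algebraMap C D (AdjoinRoot.root g)) trivial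
  rw [Algebra.linearMap_apply] at hb
  refine ⟨b, hinj _ ?_, ?_⟩
  · rw [← Polynomial.aeval_algebraMap_apply_eq_algebraMap_eval, hb,
      Polynomial.aeval_algebraMap_apply, AdjoinRoot.aeval_eq, AdjoinRoot.mk_self, map_zero]
  · have hz : (AdjoinRoot.mk g (Polynomial.C b - Polynomial.X)) * e = 0 := by
      rw [← hD, map_sub, map_sub, sub_eq_zero]
      exact hb
    have := congr(ψ $hz)
    rw [map_mul, map_zero, mul_eq_zero, or_iff_left hψe, hψmk, IsLocalRing.residue_eq_zero_iff]
      at this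
    simpa [-IsLocalRing.mem_maximalIdeal] using this

theorem kummerQuot.mk_X_pow {A : Type*} [CommRing A] {r : ℕ} (f : Fin r → A) (n : Fin r → ℕ)
    (i : Fin r) :
    (Ideal.Quotient.mk _ (X i) : kummerQuot f n) ^ n i = algebraMap A (kummerQuot f n) (f i) :=
  Ideal.Quotient.eq.mpr (Ideal.subset_span ⟨i, rfl⟩)

theorem kummerQuot.isIntegral {A : Type*} [CommRing A] {r : ℕ} (f : Fin r → A) (n : Fin r → ℕ)
    (hn : ∀ i, 0 < n i) : Algebra.IsIntegral A (kummerQuot f n) := by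
  refine ⟨fun x ↦ ?_⟩
  obtain ⟨p, rfl⟩ := Ideal.Quotient.mk_surjective x
  induction p using MvPolynomial.induction_on with
  | C a => exact isIntegral_algebraMap
  | add p q hp hq =>
    rw [map_add]
    exact hp.add hq
  | mul_X p i hp =>
    rw [map_mul]
    refine hp.mul (.of_pow (hn i) ?_)
    rw [kummerQuot.mk_X_pow]
    exact isIntegral_algebraMap


/-- `A' = A[T₁,…,T_r]/(Tᵢ^{nᵢ} − fᵢ)` over a local ring `A` with `fᵢ` in the maximal ideal is a
local ring; its maximal ideal is generated by the image of the maximal ideal of `A` together with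
the classes of the `Tᵢ`; the canonical map `A → A'` induces an isomorphism of residue fields
(expressed by surjectivity onto `A'` modulo its maximal ideal together with the statement that the
preimage of the maximal ideal of `A'` is exactly the maximal ideal of `A`); and if `A` is
henselian then so is `A'`. -/
theorem localness_and_henselianity_of_kummer_quotient
    {A : Type*} [CommRing A] [IsLocalRing A] {r : ℕ}
    (f : Fin r → A) (hf : ∀ i, f i ∈ IsLocalRing.maximalIdeal A)
    (n : Fin r → ℕ) (hn : ∀ i, 0 < n i) :
    ∃ hl : IsLocalRing (kummerQuot f n),
      (@IsLocalRing.maximalIdeal (kummerQuot f n) _ hl =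
        Ideal.span ((algebraMap A (kummerQuot f n)) '' (IsLocalRing.maximalIdeal A : Set A) ∪
          Set.range fun i : Fin r => Ideal.Quotient.mk _ (X i))) ∧
      (∀ x : kummerQuot f n, ∃ a : A,
        x - algebraMap A (kummerQuot f n) a ∈ @IsLocalRing.maximalIdeal (kummerQuot f n) _ hl) ∧
      ((@IsLocalRing.maximalIdeal (kummerQuot f n) _ hl).comap
          (algebraMap A (kummerQuot f n)) = IsLocalRing.maximalIdeal A) ∧
      (HenselianLocalRing A → HenselianLocalRing (kummerQuot f n)) := by
  set m := IsLocalRing.maximalIdeal A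
  set B := kummerQuot f n
  set J : Ideal B := Ideal.span (algebraMap A B '' (m : Set A) ∪
    Set.range fun i : Fin r => Ideal.Quotient.mk _ (X i)) with hJ
  have : Algebra.IsIntegral A B := kummerQuot.isIntegral f n hn
  have hmod (x : B) : ∃ a : A, x - algebraMap A B a ∈ J := by
    obtain ⟨p, rfl⟩ := Ideal.Quotient.mk_surjective x
    induction p using MvPolynomial.induction_on with
    | C a => exact ⟨a, (sub_self (algebraMap A B a)).symm ▸ J.zero_mem⟩
    | add p q hp hq =>
      obtain ⟨a, ha⟩ := hp
      obtain ⟨b, hb⟩ := hq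
      refine ⟨a + b, ?_⟩
      rw [map_add, map_add, add_sub_add_comm]
      exact J.add_mem ha hb
    | mul_X p i _ =>
      refine ⟨0, ?_⟩
      rw [map_zero, sub_zero, map_mul]
      exact J.mul_mem_left _ (Ideal.subset_span (.inr ⟨i, rfl⟩))
  have hcomap (M : Ideal B) [M.IsMaximal] : M.comap (algebraMap A B) = m :=
    IsLocalRing.eq_maximalIdeal (Ideal.isMaximal_comap_of_isIntegral_of_isMaximal M)
  have hmax (M : Ideal B) (hM : M.IsMaximal) : M = J := by
    have hJM : J ≤ M := by
      rw [hJ, Ideal.span_le]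
      rintro _ (⟨a, ha, rfl⟩ | ⟨i, rfl⟩)
      · exact (hcomap M).ge ha
      · refine hM.isPrime.mem_of_pow_mem (n i) ?_
        rw [kummerQuot.mk_X_pow]
        exact (hcomap M).ge (hf i)
    refine le_antisymm (fun x hx ↦ ?_) hJM
    obtain ⟨a, ha⟩ := hmod x
    have haM : algebraMap A B a ∈ M := (Submodule.sub_mem_iff_right _ hx).mp (hJM ha)
    refine (Submodule.sub_mem_iff_left _ (Ideal.subset_span (.inl ⟨a, ?_, rfl⟩))).mp ha
    exact (hcomap M).le haM
  have hB : Nontrivial B := by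
    let φ : B →+* IsLocalRing.ResidueField A :=
      Ideal.Quotient.lift _ (eval₂Hom (IsLocalRing.residue A) 0) fun x hx ↦ by
        refine (Ideal.span_le (I := RingHom.ker _)).mpr ?_ hx
        rintro _ ⟨i, rfl⟩
        simpa [(hn i).ne'] using (IsLocalRing.mem_maximalIdeal _).mp (hf i)
    exact φ.domain_nontrivial
  have hl : IsLocalRing B := by
    obtain ⟨M, hM⟩ := Ideal.exists_maximal B
    exact .of_unique_max_ideal ⟨M, hM, fun N hN ↦ (hmax N hN).trans (hmax M hM).symm⟩
  have hmaxJ : IsLocalRing.maximalIdeal B = J := hmax _ inferInstance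
  exact ⟨hl, hmaxJ, hmaxJ ▸ hmod, hcomap _, fun _ ↦ .of_isIntegral A⟩
end

section
/- Let A be a regular local ring with maximal ideal m and residue field k, let f_1,…,f_r ∈ m be elements whose images in m/m² are linearly independent over k (i.e., f_1,…,f_r form part of a regular system of parameters), let n be a positive integer invertible in A, and let K be the fraction field of A. Then the K-algebra L_n = K[X_1,…,X_r]/(X_1^{n} − f_1, …, X_r^{n} − f_r) is a field, and its dimension as a K-vector space equals n^r. -/
open MvPolynomial

/-- `L_n = K[X₁,…,X_r]/(X₁ⁿ − f₁, …, X_rⁿ − f_r)` over the fraction field `K` of `A`. -/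
abbrev kummerFieldAlg (A : Type*) [CommRing A] [IsDomain A] {r : ℕ} (f : Fin r → A) (n : ℕ) :
    Type _ :=
  MvPolynomial (Fin r) (FractionRing A) ⧸
    Ideal.span (Set.range fun i : Fin r =>
      (X i : MvPolynomial (Fin r) (FractionRing A)) ^ n - C (algebraMap A (FractionRing A) (f i)))

section

open IsLocalRing

theorem Ideal.spanFinrank_span_range_fin_le {A : Type*} [CommRing A] {s : ℕ} (g : Fin s → A) :
    (Ideal.span (Set.range g)).spanFinrank ≤ s := by
  refine (Submodule.spanFinrank_span_le_ncard_of_finite (Set.finite_range g)).trans ?_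
  rw [← Set.image_univ]
  exact (Set.ncard_image_le (s := Set.univ)).trans (by simp)

theorem exists_maximalIdeal_eq_span_union_range_of_linearIndependent {A : Type*} [CommRing A]
    [IsLocalRing A] [IsNoetherianRing A] {r : ℕ} (f : Fin r → maximalIdeal A)
    (hf : LinearIndependent (ResidueField A) fun i => (maximalIdeal A).toCotangent (f i)) :
    ∃ (s : ℕ) (g : Fin s → A),
      Ideal.span (Set.range (fun i => (f i : A)) ∪ Set.range g) = maximalIdeal A ∧
        r + s = (maximalIdeal A).spanFinrank := by
  classical
  set v : Fin r → CotangentSpace A := fun i => (maximalIdeal A).toCotangent (f i) with hv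
  set T : Set (CotangentSpace A) := hf.linearIndepOn_id.extend (Set.subset_univ _) with hT
  have hvT : Set.range v ⊆ T := hf.linearIndepOn_id.subset_extend _
  let b := Module.Basis.extend hf.linearIndepOn_id
  have hTspan : Submodule.span (ResidueField A) T = ⊤ := by
    rw [← b.span_eq, Module.Basis.range_extend]
  have hTfin : Finite T := Module.Finite.finite_basis b
  have hTcard : T.ncard = Module.finrank (ResidueField A) (CotangentSpace A) :=
    (Module.finrank_eq_nat_card_basis b).symm
  have hvcard : (Set.range v).ncard = r := by
    rw [← Set.image_univ, Set.ncard_image_of_injective _ hf.injective, Set.ncard_univ, Nat.card_fin]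
  let e : Fin (T \ Set.range v).ncard ≃ ↥(T \ Set.range v) :=
    (Finite.equivFinOfCardEq rfl).symm
  choose l hl using (maximalIdeal A).toCotangent_surjective
  refine ⟨(T \ Set.range v).ncard, fun j => (l (e j) : A), ?_, ?_⟩
  · have hS : Submodule.span A (Set.range f ∪ Set.range fun j => l (e j)) = ⊤ := by
      rw [← CotangentSpace.span_image_eq_top_iff, eq_top_iff, ← hTspan]
      apply Submodule.span_mono
      intro t ht
      by_cases h : t ∈ Set.range v
      · obtain ⟨i, rfl⟩ := h
        exact ⟨f i, Or.inl ⟨i, rfl⟩, rfl⟩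
      · exact ⟨l t, Or.inr ⟨e.symm ⟨t, ht, h⟩, by simp⟩, hl t⟩
    have := congrArg (Submodule.map (maximalIdeal A).subtype) hS
    rw [Submodule.map_span, Submodule.map_top, Submodule.range_subtype, Set.image_union,
      ← Set.range_comp, ← Set.range_comp] at this
    exact this
  · rw [spanFinrank_maximalIdeal_eq_finrank_cotangentSpace, ← hTcard,
      ← Set.ncard_sdiff_add_ncard_of_subset hvT, hvcard, add_comm]

theorem linearIndependent_toCotangent_of_notMem_sq {A : Type*} [CommRing A] [IsLocalRing A]
    {x : A} (hx : x ∈ maximalIdeal A) (hx2 : x ∉ maximalIdeal A ^ 2) :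
    LinearIndependent (ResidueField A)
      fun _ : Fin 1 => (maximalIdeal A).toCotangent ⟨x, hx⟩ := by
  have h : (maximalIdeal A).toCotangent ⟨x, hx⟩ ≠ 0 := by
    simpa [Ideal.toCotangent_eq_zero] using hx2
  have key : ∀ {k V : Type _} [Field k] [AddCommGroup V] [Module k V] (v : V), v ≠ 0 →
      LinearIndependent k fun _ : Fin 1 => v := fun v hv =>
    linearIndependent_unique_iff.2 hv
  exact key (V := CotangentSpace A) _ h

/-- A regular local ring is an integral domain. -/
theorem isDomain_of_isRegularLocalRing (A : Type*) [CommRing A] [IsRegularLocalRing A] :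
    IsDomain A := by
  induction hd : (maximalIdeal A).spanFinrank generalizing A with
  | zero =>
    rw [Submodule.spanFinrank_eq_zero_iff_eq_bot (maximalIdeal A).fg_of_isNoetherianRing,
      ← isField_iff_maximalIdeal_eq] at hd
    exact hd.isDomain
  | succ d ih =>
    have hdim : ringKrullDim A = (d + 1 : ℕ) := by
      rw [← IsRegularLocalRing.spanFinrank_maximalIdeal, hd]
    have hfin := minimalPrimes.finite_of_isNoetherianRing A
    obtain ⟨x, hxm, hx2, hxp⟩ : ∃ x ∈ maximalIdeal A, x ∉ maximalIdeal A ^ 2 ∧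
        ∀ p ∈ minimalPrimes A, x ∉ p := by
      by_contra! hcon
      have hsub : (maximalIdeal A : Set A) ⊆
          ⋃ i ∈ (↑(insert (maximalIdeal A ^ 2) hfin.toFinset) : Set (Ideal A)), (i : Set A) := by
        intro x hx
        by_cases h : x ∈ maximalIdeal A ^ 2
        · exact Set.mem_biUnion (by simp) h
        · obtain ⟨p, hp, hxp⟩ := hcon x hx h
          exact Set.mem_biUnion (by simp [hp]) hxp
      obtain ⟨p, hp, hle⟩ := (Ideal.subset_union_prime (f := id) (maximalIdeal A ^ 2)
        (maximalIdeal A ^ 2) fun i hi h _ => by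
          rw [Finset.mem_insert, or_iff_right h, Set.Finite.mem_toFinset] at hi
          exact hi.1.1).1 hsub
      rw [Finset.mem_insert, Set.Finite.mem_toFinset] at hp
      rcases hp with rfl | hp
      · have hbot : maximalIdeal A = ⊥ :=
          Submodule.eq_bot_of_le_smul_of_le_jacobson_bot (maximalIdeal A) _
            (maximalIdeal A).fg_of_isNoetherianRing (by simpa [pow_two] using hle)
            (IsLocalRing.maximalIdeal_le_jacobson _)
        rw [hbot] at hd
        simp at hd
      · have : p.IsPrime := hp.1.1
        have hpm : maximalIdeal A = p := le_antisymm hle (le_maximalIdeal this.ne_top)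
        have h0 := Ideal.height_eq_zero_iff.2 hp
        rw [← hpm] at h0
        have := maximalIdeal_height_eq_ringKrullDim (R := A)
        rw [h0, hdim] at this
        norm_cast at this
    obtain ⟨s, g, hspan, hs⟩ :=
      exists_maximalIdeal_eq_span_union_range_of_linearIndependent (fun _ => ⟨x, hxm⟩)
        (linearIndependent_toCotangent_of_notMem_sq hxm hx2)
    have hle : Ideal.span {x} ≤ maximalIdeal A := by simpa [Ideal.span_le] using hxm
    have : Nontrivial (A ⧸ Ideal.span {x}) :=
      Ideal.Quotient.nontrivial_iff.2 (ne_top_of_le_ne_top Ideal.IsPrime.ne_top' hle)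
    have : IsLocalRing (A ⧸ Ideal.span {x}) :=
      .of_surjective' (Ideal.Quotient.mk _) Ideal.Quotient.mk_surjective
    have hmax : maximalIdeal (A ⧸ Ideal.span {x}) =
        Ideal.span (Set.range (Ideal.Quotient.mk (Ideal.span {x}) ∘ g)) := by
      have h1 : (maximalIdeal A).map (Ideal.Quotient.mk (Ideal.span {x})) =
          maximalIdeal (A ⧸ Ideal.span {x}) :=
        map_maximalIdeal_of_surjective _ Ideal.Quotient.mk_surjective
      rw [← h1, ← hspan, Ideal.map_span, Set.image_union, Ideal.span_union, ← Set.range_comp,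
        ← Set.range_comp]
      apply sup_eq_right.2
      rw [Ideal.span_le]
      rintro _ ⟨_, rfl⟩
      simp
    have hrank : (maximalIdeal (A ⧸ Ideal.span {x})).spanFinrank ≤ s := by
      rw [hmax]
      exact Ideal.spanFinrank_span_range_fin_le _
    have hdimq : ((d : ℕ) : WithBot ℕ∞) ≤ ringKrullDim (A ⧸ Ideal.span {x}) := by
      have := Ideal.height_le_ringKrullDim_quotient_add_one hxm
      rw [maximalIdeal_height_eq_ringKrullDim, hdim, Nat.cast_succ] at this
      exact ENat.WithBot.add_le_add_one_right_iff.1 this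
    have hsd : s = d := by omega
    have : IsRegularLocalRing (A ⧸ Ideal.span {x}) :=
      .of_spanFinrank_maximalIdeal_le _
        ((Nat.cast_le.2 (hsd ▸ hrank)).trans hdimq)
    have hdom := ih (A ⧸ Ideal.span {x}) <| by
      refine le_antisymm (hsd ▸ hrank) ?_
      rw [← IsRegularLocalRing.spanFinrank_maximalIdeal] at hdimq
      exact_mod_cast hdimq
    have hprime : (Ideal.span {x}).IsPrime := (Ideal.Quotient.isDomain_iff_prime _).1 hdom
    obtain ⟨p, hp, hpx⟩ := Ideal.exists_minimalPrimes_le (bot_le : ⊥ ≤ Ideal.span {x})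
    have hpp : p.IsPrime := hp.1.1
    have hpbot : p = ⊥ := by
      refine Submodule.eq_bot_of_le_smul_of_le_jacobson_bot (maximalIdeal A) _
        p.fg_of_isNoetherianRing (fun y hy => ?_) (IsLocalRing.maximalIdeal_le_jacobson _)
      obtain ⟨z, rfl⟩ := Ideal.mem_span_singleton'.1 (hpx hy)
      have hz : z ∈ p := (hpp.mem_or_mem hy).resolve_right (hxp p hp)
      rw [mul_comm]
      exact Ideal.mul_mem_mul hxm hz
    rw [hpbot] at hpp
    exact IsDomain.of_bot_isPrime A

theorem AdjoinRoot.isLocalRing_X_pow_sub_C {A : Type*} [CommRing A]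
    [IsLocalRing A] [IsNoetherianRing A]
    (a : A) {S : Set A} (hS : Ideal.span (insert a S) = maximalIdeal A) {n : ℕ} (hn : 0 < n) :
    ∃ _ : IsLocalRing (AdjoinRoot (Polynomial.X ^ n - Polynomial.C a)),
      maximalIdeal (AdjoinRoot (Polynomial.X ^ n - Polynomial.C a)) =
        Ideal.span (insert (AdjoinRoot.root _) (AdjoinRoot.of _ '' S)) ∧
      ringKrullDim A ≤ ringKrullDim (AdjoinRoot (Polynomial.X ^ n - Polynomial.C a)) := by
  set q : Polynomial A := Polynomial.X ^ n - Polynomial.C a with hq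
  have hmonic : q.Monic := Polynomial.monic_X_pow_sub_C a hn.ne'
  have hdeg : q.natDegree = n := Polynomial.natDegree_X_pow_sub_C
  have := hmonic.finite_adjoinRoot
  have := hmonic.free_adjoinRoot
  have : Nontrivial (AdjoinRoot q) := by
    refine Ideal.Quotient.nontrivial_iff.2 ?_
    rw [Ne, Ideal.span_singleton_eq_top, hmonic.isUnit_iff]
    intro h
    rw [h, Polynomial.natDegree_one] at hdeg
    omega
  have hroot : AdjoinRoot.root q ^ n = AdjoinRoot.of q a := by
    have := AdjoinRoot.eval₂_root q
    simpa [hq, sub_eq_zero] using this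
  set N : Ideal (AdjoinRoot q) := Ideal.span (insert (AdjoinRoot.root q) (AdjoinRoot.of q '' S))
  have hmN : maximalIdeal A ≤ N.comap (algebraMap A (AdjoinRoot q)) := by
    rw [← hS, Ideal.span_le]
    rintro y (rfl | hy)
    · change AdjoinRoot.of q y ∈ N
      rw [← hroot]
      exact N.pow_mem_of_mem (Ideal.subset_span (Set.mem_insert _ _)) _ hn
    · exact Ideal.subset_span (Set.mem_insert_of_mem _ ⟨y, hy, rfl⟩)
  have hle : ∀ M : Ideal (AdjoinRoot q), M.IsMaximal → N ≤ M := by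
    intro M hM
    have h1 : M.comap (algebraMap A (AdjoinRoot q)) = maximalIdeal A :=
      eq_maximalIdeal (Ideal.isMaximal_comap_of_isIntegral_of_isMaximal M)
    have h2 : ∀ y ∈ insert a S, AdjoinRoot.of q y ∈ M := fun y hy => by
      have : y ∈ maximalIdeal A := hS ▸ Ideal.subset_span hy
      rwa [← h1] at this
    rw [Ideal.span_le]
    rintro y (rfl | ⟨z, hz, rfl⟩)
    · exact hM.isPrime.mem_of_pow_mem n (hroot ▸ h2 a (Set.mem_insert _ _))
    · exact h2 z (Set.mem_insert_of_mem _ hz)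
  have hsurj : Function.Surjective ((Ideal.Quotient.mk N).comp (algebraMap A (AdjoinRoot q))) := by
    intro y
    obtain ⟨y, rfl⟩ := Ideal.Quotient.mk_surjective y
    obtain ⟨p, rfl⟩ := AdjoinRoot.mk_surjective y
    refine ⟨p.coeff 0, Ideal.Quotient.eq.2 ?_⟩
    change AdjoinRoot.mk q (Polynomial.C (p.coeff 0)) - _ ∈ N
    nth_rw 2 [← Polynomial.X_mul_divX_add p]
    rw [map_add, map_mul, AdjoinRoot.mk_X, sub_add_cancel_right, neg_mem_iff]
    exact N.mul_mem_right _ (Ideal.subset_span (Set.mem_insert _ _))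
  have hNtop : N ≠ ⊤ := by
    obtain ⟨M, hM⟩ := Ideal.exists_maximal (AdjoinRoot q)
    exact ne_top_of_le_ne_top hM.ne_top (hle M hM)
  have hNmax : N.IsMaximal := by
    have : Nontrivial (AdjoinRoot q ⧸ N) := Ideal.Quotient.nontrivial_iff.2 hNtop
    have h0 : (maximalIdeal A).map
        ((Ideal.Quotient.mk N).comp (algebraMap A (AdjoinRoot q))) = ⊥ := by
      rw [← Ideal.map_map, eq_bot_iff, ← Ideal.map_quotient_self N]
      exact Ideal.map_mono (Ideal.map_le_iff_le_comap.2 hmN)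
    have h1 := Ideal.map_eq_top_or_isMaximal_of_surjective _ hsurj (maximalIdeal.isMaximal A)
    rw [h0, or_iff_right bot_ne_top] at h1
    exact Ideal.bot_quotient_isMaximal_iff N |>.1 h1
  have hloc : IsLocalRing (AdjoinRoot q) :=
    .of_unique_max_ideal ⟨N, hNmax, fun M hM => (hNmax.eq_of_le hM.ne_top (hle M hM)).symm⟩
  have hmax := (eq_maximalIdeal hNmax).symm
  refine ⟨hloc, hmax, ?_⟩
  have : (maximalIdeal (AdjoinRoot q)).LiesOver (maximalIdeal A) :=
    ⟨(eq_maximalIdeal (Ideal.isMaximal_comap_of_isIntegral_of_isMaximal _)).symm⟩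
  rw [← maximalIdeal_height_eq_ringKrullDim, ← maximalIdeal_height_eq_ringKrullDim,
    Ideal.height_eq_height_add_of_liesOver_of_hasGoingDown (maximalIdeal A)
      (maximalIdeal (AdjoinRoot q))]
  exact_mod_cast le_self_add

theorem AdjoinRoot.linearIndependent_root_pow {A : Type*} [CommRing A] {q : Polynomial A}
    (hq : q.Monic) {n : ℕ} (hn : q.natDegree = n) :
    LinearIndependent A fun j : Fin n => AdjoinRoot.root q ^ (j : ℕ) := by
  subst hn
  have h := (AdjoinRoot.powerBasis' hq).basis.linearIndependent
  rw [PowerBasis.coe_basis] at h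
  exact h

universe u

/-- If `f` and `g` together form a regular system of parameters of `A`, then some domain over `A`
contains `n`-th roots of the `f i` whose reduced monomials are linearly independent over `A`. -/
theorem exists_isDomain_linearIndependent_prod_pow {n : ℕ} (hn : 0 < n) {r : ℕ} {A : Type u}
    [CommRing A] [IsLocalRing A] [IsNoetherianRing A] (f : Fin r → A) {s : ℕ} (g : Fin s → A)
    (hspan : Ideal.span (Set.range f ∪ Set.range g) = maximalIdeal A)
    (hdim : ((r + s : ℕ) : WithBot ℕ∞) ≤ ringKrullDim A) :
    ∃ (B : Type u) (_ : CommRing B) (_ : IsDomain B) (_ : Algebra A B) (b : Fin r → B),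
      (∀ i, b i ^ n = algebraMap A B (f i)) ∧
        LinearIndependent A fun e : Fin r → Fin n => ∏ i, b i ^ (e i : ℕ) := by
  induction r generalizing A s with
  | zero =>
    have hrank : (maximalIdeal A).spanFinrank ≤ s := by
      rw [← hspan, Set.range_eq_empty, Set.empty_union]
      exact Ideal.spanFinrank_span_range_fin_le g
    rw [zero_add] at hdim
    have : IsRegularLocalRing A :=
      .of_spanFinrank_maximalIdeal_le _ ((Nat.cast_le.2 hrank).trans hdim)
    have : IsDomain A := isDomain_of_isRegularLocalRing A
    refine ⟨A, inferInstance, this, inferInstance, Fin.elim0, fun i => i.elim0, ?_⟩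
    rw [linearIndependent_unique_iff]
    simp
  | succ r ih =>
    set q : Polynomial A := Polynomial.X ^ n - Polynomial.C (f 0) with hq
    have hmonic : q.Monic := Polynomial.monic_X_pow_sub_C (f 0) hn.ne'
    have hset : insert (f 0) (Set.range (Fin.tail f) ∪ Set.range g) =
        Set.range f ∪ Set.range g := by
      rw [← Set.insert_union, ← Fin.range_cons, Fin.cons_self_tail]
    rw [← hset] at hspan
    obtain ⟨hloc, hmax, hle⟩ := AdjoinRoot.isLocalRing_X_pow_sub_C (f 0) hspan hn
    have hdeg : q.natDegree = n := Polynomial.natDegree_X_pow_sub_C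
    have hroot : AdjoinRoot.root q ^ n = algebraMap A (AdjoinRoot q) (f 0) := by
      have := AdjoinRoot.eval₂_root q
      simpa [hq, sub_eq_zero] using this
    obtain ⟨B, _, hB, _, b, hb, hli⟩ := ih (A := AdjoinRoot q) (fun i => AdjoinRoot.of q (f i.succ))
      (Fin.cons (AdjoinRoot.root q) fun j => AdjoinRoot.of q (g j) : Fin (s + 1) → AdjoinRoot q)
      (by
        rw [hmax, Fin.range_cons, Set.union_insert, Set.image_union, ← Set.range_comp,
          ← Set.range_comp]
        rfl)
      ((Nat.cast_le.2 (by omega)).trans (hdim.trans hle))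
    let _ : Algebra A B := ((algebraMap (AdjoinRoot q) B).comp (algebraMap A _)).toAlgebra
    have : IsScalarTower A (AdjoinRoot q) B := .of_algebraMap_eq' rfl
    refine ⟨B, inferInstance, hB, inferInstance,
      Fin.cons (algebraMap _ B (AdjoinRoot.root q)) b, fun i => ?_, ?_⟩
    · refine Fin.cases ?_ (fun i => ?_) i
      · rw [Fin.cons_zero, ← map_pow, hroot, ← IsScalarTower.algebraMap_apply]
      · rw [Fin.cons_succ, hb]
        rfl
    · refine (linearIndependent_equiv' (Fin.consEquiv fun _ => Fin n) ?_).1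
        (linearIndependent_smul (AdjoinRoot.linearIndependent_root_pow hmonic hdeg) hli)
      funext e
      simp [Fin.prod_univ_succ, Fin.consEquiv, Algebra.smul_def]

end

section KummerQuotient

variable {K : Type*} [Field K] {r : ℕ} (a : Fin r → K) (n : ℕ)

theorem span_range_prod_mk_X_pow_eq_top (hn : 0 < n) :
    Submodule.span K (Set.range fun e : Fin r → Fin n =>
      ∏ i, Ideal.Quotient.mk (Ideal.span (Set.range fun i : Fin r =>
        (X i : MvPolynomial (Fin r) K) ^ n - C (a i))) (X i) ^ (e i : ℕ)) = ⊤ := by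
  set I := Ideal.span (Set.range fun i : Fin r => (X i : MvPolynomial (Fin r) K) ^ n - C (a i))
  have hX : ∀ i, Ideal.Quotient.mk I (X i) ^ n =
      algebraMap K (MvPolynomial (Fin r) K ⧸ I) (a i) := fun i => by
    rw [← map_pow]
    exact Ideal.Quotient.eq.2 (Ideal.subset_span ⟨i, rfl⟩)
  rw [eq_top_iff]
  rintro x -
  obtain ⟨p, rfl⟩ := Ideal.Quotient.mk_surjective x
  induction p using MvPolynomial.induction_on' with
  | add p q hp hq => rw [map_add]; exact add_mem hp hq
  | monomial u c =>
    have : Ideal.Quotient.mk I (monomial u c) = (c * ∏ i, a i ^ (u i / n)) •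
        ∏ i, Ideal.Quotient.mk I (X i) ^ (u i % n) := by
      refine Eq.trans ?_ (Algebra.smul_def (R := K) (A := MvPolynomial (Fin r) K ⧸ I) _ _).symm
      rw [monomial_eq, Finsupp.prod_fintype _ _ (by simp), map_mul, map_prod, map_mul, map_prod,
        mul_assoc, ← Finset.prod_mul_distrib]
      congr 1
      refine Finset.prod_congr rfl fun i _ => ?_
      rw [map_pow, map_pow, ← hX, ← pow_mul, ← pow_add, Nat.div_add_mod]
    rw [this]
    exact Submodule.smul_mem _ _
      (Submodule.subset_span ⟨fun i => ⟨u i % n, Nat.mod_lt _ hn⟩, rfl⟩)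

theorem isField_and_finrank_of_linearIndependent_prod_pow (hn : 0 < n) {E : Type*} [CommRing E]
    [IsDomain E] [Algebra K E] (b : Fin r → E) (hb : ∀ i, b i ^ n = algebraMap K E (a i))
    (hli : LinearIndependent K fun e : Fin r → Fin n => ∏ i, b i ^ (e i : ℕ)) :
    IsField (MvPolynomial (Fin r) K ⧸ Ideal.span (Set.range fun i : Fin r =>
        (X i : MvPolynomial (Fin r) K) ^ n - C (a i))) ∧
      Module.finrank K (MvPolynomial (Fin r) K ⧸ Ideal.span (Set.range fun i : Fin r =>
        (X i : MvPolynomial (Fin r) K) ^ n - C (a i))) = n ^ r := by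
  have hspan := span_range_prod_mk_X_pow_eq_top a n hn
  set I := Ideal.span (Set.range fun i : Fin r => (X i : MvPolynomial (Fin r) K) ^ n - C (a i))
  have hI : ∀ p ∈ I, aeval b p = 0 := by
    suffices I ≤ RingHom.ker (aeval b) from this
    rw [Ideal.span_le]
    rintro _ ⟨i, rfl⟩
    simp [RingHom.mem_ker, hb]
  let φ : (MvPolynomial (Fin r) K ⧸ I) →ₐ[K] E := Ideal.Quotient.liftₐ I (aeval b) hI
  have hφ : ∀ i, φ (Ideal.Quotient.mk I (X i)) = b i := fun i => by
    change aeval b (X i) = b i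
    exact aeval_X b i
  have hcomp : (φ.toLinearMap ∘ fun e : Fin r → Fin n =>
      ∏ i, Ideal.Quotient.mk I (X i) ^ (e i : ℕ)) = fun e => ∏ i, b i ^ (e i : ℕ) := by
    funext e
    simp [map_prod, map_pow, hφ]
  let B := Module.Basis.mk (LinearIndependent.of_comp φ.toLinearMap (hcomp ▸ hli)) hspan.ge
  have hinj : Function.Injective φ := by
    rw [injective_iff_map_eq_zero]
    intro x hx
    rw [← B.sum_repr x, map_sum] at hx
    have h0 := Fintype.linearIndependent_iff.1 hli (B.repr x) (by
      rw [← hx]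
      refine Finset.sum_congr rfl fun e _ => ?_
      rw [map_smul, Module.Basis.mk_apply]
      exact congrArg _ (congrFun hcomp e).symm)
    exact B.ext_elem fun i => by simp [h0 i]
  have : IsDomain (MvPolynomial (Fin r) K ⧸ I) := hinj.isDomain φ.toRingHom
  have : Module.Finite K (MvPolynomial (Fin r) K ⧸ I) := .of_basis B
  refine ⟨isField_of_isIntegral_of_isField' (Field.toIsField K), ?_⟩
  rw [Module.finrank_eq_card_basis B, Fintype.card_fun, Fintype.card_fin, Fintype.card_fin]

end KummerQuotient

/-- Let `A` be a regular local ring (a Noetherian local ring whose maximal ideal is generated by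
`dim A` elements), let `f₁,…,f_r` be elements of the maximal ideal whose images in `m/m²` are
linearly independent over the residue field, let `n` be a positive integer invertible in `A`, and
let `K` be the fraction field of `A`. Then `L_n = K[X₁,…,X_r]/(Xᵢⁿ − fᵢ)` is a field and
`[L_n : K] = nʳ`. -/
theorem kummer_algebra_over_fraction_field_is_field_of_degree_pow
    {A : Type*} [CommRing A] [IsLocalRing A] [IsNoetherianRing A] [IsDomain A]
    (hreg : ∃ s : Finset A, Ideal.span (s : Set A) = IsLocalRing.maximalIdeal A ∧
      (s.card : WithBot (WithTop ℕ)) = ringKrullDim A)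
    {r : ℕ} (f : Fin r → A) (hf : ∀ i, f i ∈ IsLocalRing.maximalIdeal A)
    (hind : LinearIndependent (IsLocalRing.ResidueField A)
      (fun i : Fin r => (IsLocalRing.maximalIdeal A).toCotangent ⟨f i, hf i⟩))
    (n : ℕ) (hn : 0 < n) (hinv : IsUnit (n : A)) :
    IsField (kummerFieldAlg A f n) ∧
      Module.finrank (FractionRing A) (kummerFieldAlg A f n) = n ^ r := by
  obtain ⟨t, ht, hcard⟩ := hreg
  obtain ⟨s, g, hspan, hs⟩ := exists_maximalIdeal_eq_span_union_range_of_linearIndependent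
    (fun i => ⟨f i, hf i⟩) hind
  have hrank : (IsLocalRing.maximalIdeal A).spanFinrank ≤ t.card := by
    rw [← ht, ← Set.ncard_coe_finset]
    exact Submodule.spanFinrank_span_le_ncard_of_finite t.finite_toSet
  obtain ⟨B, _, _, _, b, hb, hli⟩ := exists_isDomain_linearIndependent_prod_pow hn f g hspan
    (le_of_le_of_eq (Nat.cast_le.2 (hs ▸ hrank)) hcard)
  have hinj : Function.Injective (algebraMap A B) := fun x y hxy =>
    hli.smul_left_injective (fun _ => ⟨0, hn⟩) (by simp [Algebra.smul_def, hxy])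
  have : FaithfulSMul A B := (faithfulSMul_iff_algebraMap_injective A B).2 hinj
  let _ : Algebra (FractionRing A) (FractionRing B) := FractionRing.liftAlgebra A (FractionRing B)
  refine isField_and_finrank_of_linearIndependent_prod_pow _ n hn
    (fun i => algebraMap B (FractionRing B) (b i)) (fun i => ?_) ?_
  · rw [← map_pow, hb, ← IsScalarTower.algebraMap_apply, ← IsScalarTower.algebraMap_apply]
  · rw [← LinearIndependent.iff_fractionRing (R := A)]
    have := hli.map' (IsScalarTower.toAlgHom A B (FractionRing B)).toLinearMap
      (LinearMap.ker_eq_bot.2 (IsFractionRing.injective B (FractionRing B)))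
    convert! this using 2
    simp [map_prod]
end

section
/- Let Γ = N ⋊ H be a semidirect product of groups and let G be a group equipped with an action of Γ by group automorphisms such that the normal factor N acts trivially on G. The map φ ↦ (φ|_H, φ|_N) is a bijection from the set of 1-cocycles φ: Γ → G onto the set of pairs (z, η) where z: H → G is a 1-cocycle for the restricted action of H on G (i.e., z(σσ') = z(σ)·(σ•z(σ')) for all σ, σ' ∈ H), η: N → G is a group homomorphism, and the compatibility condition η(στσ⁻¹) = z(σ)·(σ•η(τ))·z(σ)⁻¹ holds for all σ ∈ H and τ ∈ N. The inverse bijection sends (z, η) to the map φ defined by φ(τσ) = η(τ)·z(σ) for τ ∈ N, σ ∈ H. -/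
/-- Let `Γ = N ⋊ H` be a semidirect product of groups acting on a group `G` by group automorphisms
in such a way that the normal factor `N` acts trivially. Then `φ ↦ (φ|_H, φ|_N)` is a bijection
from the set of 1-cocycles `φ : Γ → G` onto the set of pairs `(z, η)` where `z : H → G` is a
1-cocycle for the restricted action of `H`, `η : N → G` is a group homomorphism, and
`η(στσ⁻¹) = z(σ)·(σ•η(τ))·z(σ)⁻¹` for all `σ ∈ H`, `τ ∈ N`; the inverse bijection sends `(z, η)`
to `φ(τσ) = η(τ)·z(σ)`. -/
theorem cocycle_parametrization_arithmetic_geometric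
    {N H G : Type*} [Group N] [Group H] [Group G] (ψ : H →* MulAut N)
    [MulDistribMulAction (N ⋊[ψ] H) G]
    (htriv : ∀ (τ : N) (g : G), (SemidirectProduct.inl τ : N ⋊[ψ] H) • g = g) :
    ∃ e : {φ : (N ⋊[ψ] H) → G // ∀ γ δ : N ⋊[ψ] H, φ (γ * δ) = φ γ * γ • φ δ} ≃
        {p : (H → G) × (N → G) //
          (∀ σ σ' : H, p.1 (σ * σ') =
            p.1 σ * (SemidirectProduct.inr σ : N ⋊[ψ] H) • p.1 σ') ∧
          (∀ τ τ' : N, p.2 (τ * τ') = p.2 τ * p.2 τ') ∧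
          (∀ (σ : H) (τ : N), p.2 (ψ σ τ) =
            p.1 σ * ((SemidirectProduct.inr σ : N ⋊[ψ] H) • p.2 τ) * (p.1 σ)⁻¹)},
      (∀ φ, (e φ : (H → G) × (N → G)) =
        (fun σ : H => (φ : (N ⋊[ψ] H) → G) (SemidirectProduct.inr σ),
         fun τ : N => (φ : (N ⋊[ψ] H) → G) (SemidirectProduct.inl τ))) ∧
      (∀ p, (e.symm p : (N ⋊[ψ] H) → G) =
        fun γ : N ⋊[ψ] H =>
          (p : (H → G) × (N → G)).2 γ.left * (p : (H → G) × (N → G)).1 γ.right) := by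
  have hsmul (γ : N ⋊[ψ] H) (g : G) :
      γ • g = (SemidirectProduct.inr γ.right : N ⋊[ψ] H) • g := by
    conv_lhs => rw [← SemidirectProduct.inl_left_mul_inr_right γ, mul_smul, htriv]
  refine ⟨{
    toFun := fun φ => ⟨(fun σ => φ.1 (SemidirectProduct.inr σ),
      fun τ => φ.1 (SemidirectProduct.inl τ)), ?_, ?_, ?_⟩
    invFun := fun p => ⟨fun γ => p.1.2 γ.left * p.1.1 γ.right, ?_⟩
    left_inv := ?_
    right_inv := ?_ }, fun _ => rfl, fun _ => rfl⟩
  · intro σ σ'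
    simp only [map_mul, φ.2]
  · intro τ τ'
    simp only [map_mul, φ.2, htriv]
  · intro σ τ
    have hcomm : (SemidirectProduct.inl (ψ σ τ) * SemidirectProduct.inr σ : N ⋊[ψ] H) =
        SemidirectProduct.inr σ * SemidirectProduct.inl τ := by
      ext <;> simp
    have h := congrArg φ.1 hcomm
    rw [φ.2, φ.2, htriv] at h
    exact eq_mul_inv_of_mul_eq h
  · obtain ⟨⟨z, η⟩, hz, hη, hc⟩ := p
    dsimp only at hz hη hc ⊢
    intro γ δ
    rw [hsmul γ, SemidirectProduct.mul_left, SemidirectProduct.mul_right, hη, hc, hz, smul_mul']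
    group
  · intro φ
    ext γ
    conv_rhs => rw [← SemidirectProduct.inl_left_mul_inr_right γ, φ.2, htriv]
  · rintro ⟨⟨z, η⟩, hz, hη, hc⟩
    have hz1 : z 1 = 1 := by simpa using hz 1 1
    have hη1 : η 1 = 1 := by simpa using hη 1 1
    simp [hz1, hη1]
end

section
/- Let A be a henselian local ring with maximal ideal m and residue field k = A/m, and let S be a smooth A-algebra (i.e., an A-algebra that is of finite presentation and formally smooth). Then every A-algebra homomorphism S → k lifts to an A-algebra homomorphism S → A; that is, the map Hom_{A-alg}(S, A) → Hom_{A-alg}(S, k) induced by the reduction A → k is surjective. -/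
universe u

open IsLocalRing Polynomial

/-- Over a henselian local `B`-algebra `A`, points of a standard étale `B`-algebra valued in the
residue field of `A` lift to `A`. -/
theorem StandardEtalePair.exists_hasMap_residue_eq {B A : Type*} [CommRing B] [CommRing A]
    [HenselianLocalRing A] [Algebra B A] (P : StandardEtalePair B) {x : ResidueField A}
    (hx : P.HasMap x) : ∃ a : A, P.HasMap a ∧ residue A a = x := by
  have hroot := hx.1
  have hder := hx.isUnit_derivative_f.ne_zero
  have hensel := ((HenselianLocalRing.TFAE A).out 0 1).mp ‹_›
  obtain ⟨a, ha, rfl⟩ := hensel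
    (P.f.map (algebraMap B A)) (P.monic_f.map _) x (by simpa using hroot)
    (by simpa [derivative_map] using hder)
  refine ⟨a, ⟨by simpa [IsRoot.def, eval_map_algebraMap] using ha, ?_⟩, rfl⟩
  refine isUnit_of_map_unit (residue A) _ ?_
  simpa [← ResidueField.algebraMap_eq, aeval_algebraMap_apply] using hx.2

/-- Over a henselian local `B`-algebra `A`, homomorphisms from a standard étale `B`-algebra to the
residue field of `A` lift to `A`. -/
theorem Algebra.IsStandardEtale.exists_residue_comp_eq {B A T : Type*} [CommRing B] [CommRing A]
    [HenselianLocalRing A] [Algebra B A] [CommRing T] [Algebra B T] [Algebra.IsStandardEtale B T]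
    (f : T →ₐ[B] ResidueField A) : ∃ g : T →ₐ[B] A, ∀ t : T, residue A (g t) = f t := by
  obtain ⟨P⟩ := Algebra.IsStandardEtale.nonempty_standardEtalePresentation (R := B) (S := T)
  obtain ⟨a, ha, hax⟩ := P.P.exists_hasMap_residue_eq (P.hasMap.map f)
  refine ⟨(P.P.lift a ha).comp P.equivRing.toAlgHom, fun t ↦ ?_⟩
  obtain ⟨s, rfl⟩ := P.equivRing.symm.surjective t
  have : (IsScalarTower.toAlgHom B A (ResidueField A)).comp (P.P.lift a ha) =
      f.comp P.equivRing.symm.toAlgHom :=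
    StandardEtalePair.hom_ext (by simpa using hax)
  simpa using DFunLike.congr_fun this s

/-- Hensel's lemma for smooth algebras: if `A` is a henselian local ring with residue field `k`
and `S` is a smooth `A`-algebra (of finite presentation and formally smooth), then every
`A`-algebra homomorphism `S → k` lifts to an `A`-algebra homomorphism `S → A`. -/
theorem henselian_lifting_for_smooth_algebras
    {A : Type u} [CommRing A] [HenselianLocalRing A]
    {S : Type u} [CommRing S] [Algebra A S] [Algebra.Smooth A S]
    (f : S →ₐ[A] IsLocalRing.ResidueField A) :
    ∃ g : S →ₐ[A] A, ∀ s : S, IsLocalRing.residue A (g s) = f s := by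
  have : (RingHom.ker f).IsPrime := RingHom.ker_isPrime f
  obtain ⟨r, hr, n, _, _, _⟩ :=
    Algebra.IsSmoothAt.exists_isStandardEtale_mvPolynomial (R := A) (p := RingHom.ker f)
  have hfr : IsUnit (f r) := isUnit_iff_ne_zero.mpr hr
  let fr : Localization.Away r →ₐ[A] ResidueField A := IsLocalization.Away.liftAlgHom r hfr
  choose c hc using fun i : Fin n ↦ residue_surjective
    (fr (algebraMap (MvPolynomial (Fin n) A) (Localization.Away r) (.X i)))
  let : Algebra (MvPolynomial (Fin n) A) A := (MvPolynomial.aeval c).toAlgebra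
  have hfc : (Algebra.ofId A (ResidueField A)).comp (MvPolynomial.aeval c) =
      fr.comp (IsScalarTower.toAlgHom A (MvPolynomial (Fin n) A) (Localization.Away r)) :=
    MvPolynomial.algHom_ext fun i ↦ by simpa [Algebra.ofId_apply] using hc i
  let fr' : Localization.Away r →ₐ[MvPolynomial (Fin n) A] ResidueField A :=
    { fr with commutes' := fun b ↦ (DFunLike.congr_fun hfc b).symm }
  obtain ⟨g, hg⟩ := Algebra.IsStandardEtale.exists_residue_comp_eq fr'
  have : IsScalarTower A (MvPolynomial (Fin n) A) A := .of_algebraMap_eq fun a ↦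
    (MvPolynomial.aeval_C c a).symm
  refine ⟨(g.restrictScalars A).comp (IsScalarTower.toAlgHom A S _), fun s ↦ ?_⟩
  refine (hg _).trans ?_
  exact IsLocalization.Away.lift_eq r hfr s
end

section
/- Let K be a field, n a positive integer invertible in K, and L a finite Galois extension of K containing a primitive n-th root of unity. Let f_1,…,f_r ∈ K^× and let M be an extension of L obtained by adjoining elements α_1,…,α_r with α_i^{n} = f_i, and assume [M : L] = n^r. Then M is a finite Galois extension of K, the subgroup Gal(M/L) of Gal(M/K) is isomorphic to μ_n(L)^r via the action (ζ_1,…,ζ_r)·α_i = ζ_i·α_i, and there is a group isomorphism Gal(M/K) ≅ μ_n(L)^r ⋊ Gal(L/K), where Gal(L/K) acts on μ_n(L)^r coordinatewise through its natural action on the n-th roots of unity μ_n(L) of L. -/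
/-- Two nonzero elements with the same `n`-th power differ by an `n`-th root of unity of `L`, if `L`
contains a primitive `n`-th root of unity. -/
theorem exists_rootsOfUnity_mul_eq_of_pow_eq {L M : Type*} [Field L] [Field M] [Algebra L M]
    {n : ℕ} (hn : 0 < n) {ζ : L} (hζ : IsPrimitiveRoot ζ n) {x y : M} (hx : x ≠ 0)
    (hxy : y ^ n = x ^ n) :
    ∃ u : rootsOfUnity n L, y = algebraMap L M ((u : Lˣ) : L) * x := by
  have : NeZero n := ⟨hn.ne'⟩
  have hζM : IsPrimitiveRoot (algebraMap L M ζ) n :=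
    hζ.map_of_injective (algebraMap L M).injective
  have h1 : (y / x) ^ n = 1 := by
    rw [div_pow, hxy, div_self (pow_ne_zero n hx)]
  obtain ⟨k, -, hk⟩ := hζM.eq_pow_of_pow_eq_one h1
  refine ⟨rootsOfUnity.mkOfPowEq (ζ ^ k) ?_, ?_⟩
  · rw [← pow_mul, mul_comm, pow_mul, hζ.pow_eq_one, one_pow]
  · rw [rootsOfUnity.coe_mkOfPowEq, map_pow, hk, div_mul_cancel₀ y hx]

/-- Ring homomorphisms out of an `L`-algebra generated by a set `s` are determined by their values
on `L` and on `s`. -/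
theorem RingHom.eq_of_eqOn_algebraMap_of_adjoin_eq_top {L M N : Type*} [CommSemiring L]
    [Semiring M] [Semiring N] [Algebra L M] {s : Set M} (hs : Algebra.adjoin L s = ⊤)
    {φ ψ : M →+* N} (hL : ∀ a, φ (algebraMap L M a) = ψ (algebraMap L M a))
    (h : Set.EqOn φ ψ s) : φ = ψ := by
  ext x
  have hx : x ∈ Algebra.adjoin L s := hs ▸ Algebra.mem_top
  induction hx using Algebra.adjoin_induction with
  | mem x hx => exact h hx
  | algebraMap a => exact hL a
  | add x y _ _ hx hy => rw [map_add, map_add, hx, hy]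
  | mul x y _ _ hx hy => rw [map_mul, map_mul, hx, hy]

/-- A finite extension `M` of `K` is Galois if it is generated over a finite Galois extension `L` of
`K` by elements whose minimal polynomials over `K` are separable and split in `M`. -/
theorem IsGalois.of_adjoin_eq_top_of_separable_of_splits {K L M : Type*} [Field K] [Field L]
    [Field M] [Algebra K L] [Algebra L M] [Algebra K M] [IsScalarTower K L M]
    [FiniteDimensional K L] [IsGalois K L] [FiniteDimensional K M] {s : Set M}
    (hs : Algebra.adjoin L s = ⊤)
    (h : ∀ x ∈ s, (minpoly K x).Separable ∧ ((minpoly K x).map (algebraMap K M)).Splits) :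
    IsGalois K M := by
  let F : IntermediateField K M := (IsScalarTower.toAlgHom K L M).fieldRange
  have htop : IntermediateField.adjoin K ((F : Set M) ∪ s) = ⊤ := by
    rw [eq_top_iff]
    intro x _
    have hx : x ∈ Algebra.adjoin L s := hs ▸ Algebra.mem_top
    induction hx using Algebra.adjoin_induction with
    | mem x hx => exact IntermediateField.subset_adjoin _ _ (Or.inr hx)
    | algebraMap a => exact IntermediateField.subset_adjoin _ _ (Or.inl ⟨a, rfl⟩)
    | add x y _ _ hx hy => exact add_mem (hx trivial) (hy trivial)
    | mul x y _ _ hx hy => exact mul_mem (hx trivial) (hy trivial)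
  have hall : ∀ x ∈ (F : Set M) ∪ s,
      (minpoly K x).Separable ∧ ((minpoly K x).map (algebraMap K M)).Splits := by
    rintro x (⟨a, rfl⟩ | hx)
    · have hmin : minpoly K ((IsScalarTower.toAlgHom K L M) a) = minpoly K a :=
        minpoly.algHom_eq _ (IsScalarTower.toAlgHom K L M).injective a
      change (minpoly K ((IsScalarTower.toAlgHom K L M) a)).Separable ∧
        ((minpoly K ((IsScalarTower.toAlgHom K L M) a)).map (algebraMap K M)).Splits
      rw [hmin]
      refine ⟨IsGalois.separable K a, ?_⟩
      rw [IsScalarTower.algebraMap_eq K L M, ← Polynomial.map_map]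
      exact (IsGalois.splits K a).map _
    · exact h x hx
  have hsep : Algebra.IsSeparable K (⊤ : IntermediateField K M) := by
    rw [← htop, IntermediateField.isSeparable_adjoin_iff_isSeparable]
    exact fun x hx => (hall x hx).1
  have hM : Algebra.IsSeparable K M :=
    Algebra.IsSeparable.of_algHom K (⊤ : IntermediateField K M)
      (IntermediateField.topEquiv (F := K) (E := M)).symm.toAlgHom
  have hnorm : Normal K M := normal_iff.2 fun x =>
    ⟨Algebra.IsIntegral.isIntegral x, IntermediateField.splits_of_mem_adjoin K M
      (fun y hy => ⟨Algebra.IsIntegral.isIntegral y, (hall y hy).2⟩)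
      (htop ▸ IntermediateField.mem_top)⟩
  exact ⟨⟩


/-- The coordinatewise action of `Gal(L/K)` on `μ_n(L)^r` through its natural action on the
`n`-th roots of unity of `L`. -/
def galActionRootsOfUnity (K L : Type*) [Field K] [Field L] [Algebra K L] (n r : ℕ) :
    (L ≃ₐ[K] L) →* MulAut (Fin r → rootsOfUnity n L) :=
  MonoidHom.mk'
    (fun σ => MulEquiv.piCongrRight fun _ : Fin r => (σ : L ≃* L).restrictRootsOfUnity n)
    (by
      intro σ τ
      ext x i
      rfl)

/-- Kummer theory: let `K` be a field, `n` a positive integer invertible in `K`, and `L/K` a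
finite Galois extension containing a primitive `n`-th root of unity. Let `f₁,…,f_r ∈ K^×` and let
`M/L` be obtained by adjoining elements `α₁,…,α_r` with `αᵢⁿ = fᵢ`, with `[M:L] = nʳ`. Then `M/K`
is finite Galois, `Gal(M/L)` is isomorphic to `μ_n(L)^r` acting by `(ζ₁,…,ζ_r)·αᵢ = ζᵢαᵢ`, and
`Gal(M/K) ≅ μ_n(L)^r ⋊ Gal(L/K)` where `Gal(L/K)` acts coordinatewise through its natural action
on `μ_n(L)`; moreover the isomorphism restricts on `μ_n(L)^r` to the previous identification of
`Gal(M/L)`. -/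
theorem kummer_galois_group_semidirect_product
    {K L M : Type*} [Field K] [Field L] [Field M]
    [Algebra K L] [Algebra L M] [Algebra K M] [IsScalarTower K L M]
    [FiniteDimensional K L] [IsGalois K L]
    (n : ℕ) (hn : 0 < n) (hninv : (n : K) ≠ 0)
    (hζ : ∃ ζ : L, IsPrimitiveRoot ζ n)
    {r : ℕ} (f : Fin r → Kˣ) (α : Fin r → M)
    (hα : ∀ i, α i ^ n = algebraMap K M (f i))
    (hadj : Algebra.adjoin L (Set.range α) = ⊤)
    (hdim : Module.finrank L M = n ^ r) :
    (FiniteDimensional K M ∧ IsGalois K M) ∧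
    ∃ e : (Fin r → rootsOfUnity n L) ≃* (M ≃ₐ[L] M),
      (∀ (ζ : Fin r → rootsOfUnity n L) (i : Fin r),
        e ζ (α i) = algebraMap L M ((ζ i : Lˣ) : L) * α i) ∧
      ∃ Φ : (M ≃ₐ[K] M) ≃*
          (Fin r → rootsOfUnity n L) ⋊[galActionRootsOfUnity K L n r] (L ≃ₐ[K] L),
        ∀ ζ : Fin r → rootsOfUnity n L,
          Φ.symm (SemidirectProduct.inl ζ) = AlgEquiv.restrictScalars K (e ζ) := by
  have : NeZero n := ⟨hn.ne'⟩
  obtain ⟨ζ₀, hζ₀⟩ := hζ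
  have hα0 (i) : α i ≠ 0 := by
    rintro h
    have := hα i
    rw [h, zero_pow hn.ne'] at this
    exact (f i).ne_zero ((map_eq_zero (algebraMap K M)).1 this.symm)
  have hLM : FiniteDimensional L M :=
    Module.finite_of_finrank_pos (hdim ▸ pow_pos hn r)
  have hKM : FiniteDimensional K M := Module.Finite.trans L M
  have hgal : IsGalois K M := by
    refine IsGalois.of_adjoin_eq_top_of_separable_of_splits hadj ?_
    rintro _ ⟨i, rfl⟩
    have hdvd : minpoly K (α i) ∣ Polynomial.X ^ n - Polynomial.C (f i : K) :=
      minpoly.dvd K _ (by simp [hα])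
    refine ⟨(Polynomial.separable_X_pow_sub_C _ hninv (f i).ne_zero).of_dvd hdvd, ?_⟩
    refine Polynomial.Splits.of_dvd (g := (Polynomial.X ^ n - Polynomial.C (f i : K)).map
      (algebraMap K M)) ?_ ?_ (Polynomial.map_dvd _ hdvd)
    · rw [Polynomial.map_sub, Polynomial.map_pow, Polynomial.map_X, Polynomial.map_C]
      exact X_pow_sub_C_splits_of_isPrimitiveRoot
        (hζ₀.map_of_injective (algebraMap L M).injective) (hα i)
    · exact Polynomial.map_ne_zero (Polynomial.X_pow_sub_C_ne_zero hn _)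
  have hgalL : IsGalois L M := IsGalois.tower_top_of_isGalois K L M
  have hroot (τ : M ≃ₐ[K] M) (i) :
      ∃ u : rootsOfUnity n L, τ (α i) = algebraMap L M ((u : Lˣ) : L) * α i :=
    exists_rootsOfUnity_mul_eq_of_pow_eq hn hζ₀ (hα0 i) (by
      rw [← map_pow, hα, AlgEquiv.commutes])
  have hext {τ τ' : M ≃ₐ[K] M} (hL : ∀ a, τ (algebraMap L M a) = τ' (algebraMap L M a))
      (h : ∀ i, τ (α i) = τ' (α i)) : τ = τ' := by
    have := RingHom.eq_of_eqOn_algebraMap_of_adjoin_eq_top (φ := (τ : M →+* M))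
      (ψ := (τ' : M →+* M)) hadj hL (by rintro _ ⟨i, rfl⟩; exact h i)
    exact AlgEquiv.ext fun x => RingHom.congr_fun this x
  have hcancel {i} {u v : rootsOfUnity n L}
      (h : algebraMap L M ((u : Lˣ) : L) * α i = algebraMap L M ((v : Lˣ) : L) * α i) : u = v :=
    Subtype.ext (Units.ext ((algebraMap L M).injective (mul_right_cancel₀ (hα0 i) h)))
  choose c hc using fun (τ : M ≃ₐ[L] M) i => hroot (τ.restrictScalars K) i
  replace hc (τ : M ≃ₐ[L] M) (i) : τ (α i) = algebraMap L M ((c τ i : Lˣ) : L) * α i := hc τ i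
  let κ : (M ≃ₐ[L] M) →* (Fin r → rootsOfUnity n L) := MonoidHom.mk' c (by
    intro τ τ'
    funext i
    apply hcancel (i := i)
    rw [← hc, AlgEquiv.mul_apply, hc τ' i, map_mul, AlgEquiv.commutes, hc τ i, Pi.mul_apply,
      Subgroup.coe_mul, Units.val_mul, map_mul]
    ring)
  have hκinj : Function.Injective κ := by
    intro τ τ' h
    apply AlgEquiv.restrictScalars_injective K
    refine hext (fun a => ?_) (fun i => ?_)
    · change τ _ = τ' _
      rw [τ.commutes, τ'.commutes]
    · change τ _ = τ' _
      rw [hc, hc, show c τ = c τ' from h]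
  have hκ : Function.Bijective κ := by
    rw [Nat.bijective_iff_injective_and_card]
    refine ⟨hκinj, ?_⟩
    rw [IsGalois.card_aut_eq_finrank, hdim, Nat.card_fun, hζ₀.card_rootsOfUnity,
      Nat.card_fin]
  let e := (MulEquiv.ofBijective κ hκ).symm
  have he (ζ : Fin r → rootsOfUnity n L) (i) :
      e ζ (α i) = algebraMap L M ((ζ i : Lˣ) : L) * α i := by
    rw [hc, show c (e ζ) = ζ from (MulEquiv.ofBijective κ hκ).apply_symm_apply ζ]
  have hlift (σ : L ≃ₐ[K] L) : ∃ τ : M ≃ₐ[K] M,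
      (∀ a, τ (algebraMap L M a) = algebraMap L M (σ a)) ∧ ∀ i, τ (α i) = α i := by
    choose u hu using hroot (σ.liftNormal M)
    refine ⟨(e u⁻¹).restrictScalars K * σ.liftNormal M, fun a => ?_, fun i => ?_⟩
    · rw [AlgEquiv.mul_apply, AlgEquiv.liftNormal_commutes, AlgEquiv.restrictScalars_apply,
        AlgEquiv.commutes]
    · rw [AlgEquiv.mul_apply, hu, AlgEquiv.restrictScalars_apply, map_mul, AlgEquiv.commutes, he,
        ← mul_assoc, ← map_mul]
      simp
  choose s hsL hsα using hlift
  let S : (L ≃ₐ[K] L) →* (M ≃ₐ[K] M) := MonoidHom.mk' s (by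
    intro σ σ'
    refine hext (fun a => ?_) (fun i => ?_)
    · simp [hsL]
    · simp [hsα])
  let E : (Fin r → rootsOfUnity n L) →* (M ≃ₐ[K] M) :=
    MonoidHom.mk' (fun ζ => (e ζ).restrictScalars K) (by
      intro ζ ζ'
      rw [map_mul]
      rfl)
  have hEL (ζ a) : E ζ (algebraMap L M a) = algebraMap L M a := (e ζ).commutes a
  have hEα (ζ i) : E ζ (α i) = algebraMap L M ((ζ i : Lˣ) : L) * α i := he ζ i
  have hSL (σ a) : S σ (algebraMap L M a) = algebraMap L M (σ a) := hsL σ a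
  have hSα (σ i) : S σ (α i) = α i := hsα σ i
  have hcompat (σ : L ≃ₐ[K] L) : E.comp (galActionRootsOfUnity K L n r σ).toMonoidHom =
      (MulAut.conj (S σ)).toMonoidHom.comp E := by
    ext1 ζ
    change E (galActionRootsOfUnity K L n r σ ζ) = S σ * E ζ * (S σ)⁻¹
    rw [eq_mul_inv_iff_mul_eq]
    refine hext (fun a => ?_) (fun i => ?_)
    · simp only [AlgEquiv.mul_apply, hSL, hEL]
    · simp only [AlgEquiv.mul_apply, hSα, hEα, map_mul, hSL]
      rfl
  let Ψ := SemidirectProduct.lift E S hcompat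
  have hΨ (g) : Ψ g = E g.left * S g.right := rfl
  have hΨinj : Function.Injective Ψ := by
    intro g g' h
    rw [hΨ, hΨ] at h
    refine SemidirectProduct.ext (funext fun i => hcancel (i := i) ?_) (AlgEquiv.ext fun a => ?_)
    · simpa only [AlgEquiv.mul_apply, hSα, hEα] using DFunLike.congr_fun h (α i)
    · apply (algebraMap L M).injective
      simpa only [AlgEquiv.mul_apply, hSL, hEL] using DFunLike.congr_fun h (algebraMap L M a)
  have hΨsurj : Function.Surjective Ψ := by
    intro τ
    choose u hu using hroot τ
    refine ⟨⟨u, τ.restrictNormal L⟩, ?_⟩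
    rw [hΨ]
    refine hext (fun a => ?_) (fun i => ?_)
    · rw [AlgEquiv.mul_apply, hSL, hEL, AlgEquiv.restrictNormal_commutes]
    · rw [AlgEquiv.mul_apply, hSα, hEα, hu]
  refine ⟨⟨hKM, hgal⟩, e, he, (MulEquiv.ofBijective Ψ ⟨hΨinj, hΨsurj⟩).symm, fun ζ => ?_⟩
  exact SemidirectProduct.lift_inl E S hcompat ζ
end
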